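/- arXiv:2212.02607 — 10 statements merged into one kernel-verified Lean document; each statement's English description precedes it below -/
import Mathlib

section
/- Let S be a set with subsets X, Y such that X ∪ Y = S and Z := X ∩ Y is nonempty. Let d_X be an ultrametric on X and d_Y an ultrametric on Y that agree on Z × Z. Define d : S × S → ℝ by d = d_X on X × X, d = d_Y on Y × Y, and, for x ∈ X \ Z and y ∈ Y \ Z, d(x,y) = d(y,x) = inf_{z ∈ Z} max(d_X(x,z), d_Y(z,y)). Assume that for every x ∈ X \ Z and y ∈ Y \ Z this infimum is attained at some z ∈ Z (this holds, for instance, when Z is finite). Then d is well defined (the defining clauses agree wherever they overlap) and d is an ultrametric on S: d(a,b) = 0 if and only if a = b, d(a,b) = d(b,a), and d(a,c) ≤ max(d(a,b), d(b,c)) for all a, b, c ∈ S. -/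
/-- **Amalgamation of ultrametric spaces** (Bogatyi).
Let `S` be a set with subsets `X`, `Y` such that `X ∪ Y = S` and `Z := X ∩ Y` is nonempty.
Given ultrametrics `dX` on `X` and `dY` on `Y` agreeing on `Z`, such that for every
`x ∈ X \ Z`, `y ∈ Y \ Z` the infimum `inf_{z ∈ Z} max (dX x z) (dY z y)` is attained,
there is a well-defined ultrametric `d` on `S` extending `dX` and `dY`, given on
cross pairs by this infimum. -/
theorem ultrametric_amalgamation
    (S : Type*) (X Y : Set S) (hXY : X ∪ Y = Set.univ)
    (Z : Set S) (hZ : Z = X ∩ Y) (hZne : Z.Nonempty)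
    (dX dY : S → S → ℝ)
    (hX0 : ∀ a ∈ X, ∀ b ∈ X, (dX a b = 0 ↔ a = b))
    (hXs : ∀ a ∈ X, ∀ b ∈ X, dX a b = dX b a)
    (hXu : ∀ a ∈ X, ∀ b ∈ X, ∀ c ∈ X, dX a c ≤ max (dX a b) (dX b c))
    (hY0 : ∀ a ∈ Y, ∀ b ∈ Y, (dY a b = 0 ↔ a = b))
    (hYs : ∀ a ∈ Y, ∀ b ∈ Y, dY a b = dY b a)
    (hYu : ∀ a ∈ Y, ∀ b ∈ Y, ∀ c ∈ Y, dY a c ≤ max (dY a b) (dY b c))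
    (hagree : ∀ a ∈ Z, ∀ b ∈ Z, dX a b = dY a b)
    (hattain : ∀ x ∈ X \ Z, ∀ y ∈ Y \ Z, ∃ z ∈ Z,
      ∀ z' ∈ Z, max (dX x z) (dY z y) ≤ max (dX x z') (dY z' y)) :
    ∃ d : S → S → ℝ,
      (∀ a ∈ X, ∀ b ∈ X, d a b = dX a b) ∧
      (∀ a ∈ Y, ∀ b ∈ Y, d a b = dY a b) ∧
      (∀ x ∈ X \ Z, ∀ y ∈ Y \ Z,
        d x y = sInf {t : ℝ | ∃ z ∈ Z, t = max (dX x z) (dY z y)} ∧ d y x = d x y) ∧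
      (∀ a b : S, (d a b = 0 ↔ a = b)) ∧
      (∀ a b : S, d a b = d b a) ∧
      (∀ a b c : S, d a c ≤ max (d a b) (d b c)) := by
  classical
  subst hZ
  have nonnegX : ∀ a ∈ X, ∀ b ∈ X, 0 ≤ dX a b := fun a ha b hb => by
    have h := hXu a ha b hb a ha
    rwa [(hX0 a ha a ha).2 rfl, ← hXs a ha b hb, max_self] at h
  have nonnegY : ∀ a ∈ Y, ∀ b ∈ Y, 0 ≤ dY a b := fun a ha b hb => by
    have h := hYu a ha b hb a ha
    rwa [(hY0 a ha a ha).2 rfl, ← hYs a ha b hb, max_self] at h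
  let m : S → S → ℝ := fun x y => sInf {t : ℝ | ∃ z ∈ X ∩ Y, t = max (dX x z) (dY z y)}
  let d : S → S → ℝ := fun a b =>
    if a ∈ X ∧ b ∈ X then dX a b
    else if a ∈ Y ∧ b ∈ Y then dY a b
    else if a ∈ X then m a b else m b a
  have cover : ∀ a, a ∈ X ∨ a ∈ Y := fun a => hXY.ge (Set.mem_univ a)
  have dXX : ∀ a ∈ X, ∀ b ∈ X, d a b = dX a b := fun a ha b hb => if_pos ⟨ha, hb⟩
  have dYY : ∀ a ∈ Y, ∀ b ∈ Y, d a b = dY a b := fun a ha b hb => by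
    by_cases h : a ∈ X ∧ b ∈ X
    · rw [dXX a h.1 b h.2, hagree a ⟨h.1, ha⟩ b ⟨h.2, hb⟩]
    · simp only [d, if_neg h, if_pos (And.intro ha hb)]
  have dsymm : ∀ a b, d a b = d b a := fun a b => by
    by_cases ha : a ∈ X <;> by_cases hb : b ∈ X
    · rw [dXX a ha b hb, dXX b hb a ha, hXs a ha b hb]
    · have hbY := (cover b).resolve_left hb
      by_cases haY : a ∈ Y
      · rw [dYY a haY b hbY, dYY b hbY a haY, hYs a haY b hbY]
      · simp [d, ha, hb, haY]
    · have haY := (cover a).resolve_left ha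
      by_cases hbY : b ∈ Y
      · rw [dYY a haY b hbY, dYY b hbY a haY, hYs a haY b hbY]
      · simp [d, ha, hb, hbY]
    · have haY := (cover a).resolve_left ha
      have hbY := (cover b).resolve_left hb
      rw [dYY a haY b hbY, dYY b hbY a haY, hYs a haY b hbY]
  have dcross : ∀ x ∈ X \ (X ∩ Y), ∀ y ∈ Y \ (X ∩ Y), d x y = m x y := fun x hx y hy => by
    have hxY : x ∉ Y := fun h => hx.2 ⟨hx.1, h⟩
    have hyX : y ∉ X := fun h => hy.2 ⟨h, hy.1⟩
    simp [d, hx.1, hxY, hyX]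
  have dleast : ∀ x ∈ X, ∀ y ∈ Y, ∃ z ∈ X ∩ Y, d x y = max (dX x z) (dY z y) ∧
      ∀ w ∈ X ∩ Y, d x y ≤ max (dX x w) (dY w y) := fun x hx y hy => by
    by_cases hxY : x ∈ Y
    · refine ⟨x, ⟨hx, hxY⟩, ?_, fun w hw => ?_⟩
      · rw [dYY x hxY y hy, (hX0 x hx x hx).2 rfl, max_eq_right (nonnegY x hxY y hy)]
      · rw [dYY x hxY y hy, hagree x ⟨hx, hxY⟩ w hw]
        exact hYu x hxY w hw.2 y hy
    by_cases hyX : y ∈ X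
    · refine ⟨y, ⟨hyX, hy⟩, ?_, fun w hw => ?_⟩
      · rw [dXX x hx y hyX, (hY0 y hy y hy).2 rfl, max_eq_left (nonnegX x hx y hyX)]
      · rw [dXX x hx y hyX, ← hagree w hw y ⟨hyX, hy⟩]
        exact hXu x hx w hw.1 y hyX
    have hx' : x ∈ X \ (X ∩ Y) := ⟨hx, fun h => hxY h.2⟩
    have hy' : y ∈ Y \ (X ∩ Y) := ⟨hy, fun h => hyX h.1⟩
    obtain ⟨z, hz, hmin⟩ := hattain x hx' y hy'
    have hm : m x y = max (dX x z) (dY z y) := by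
      refine IsLeast.csInf_eq ⟨⟨z, hz, rfl⟩, ?_⟩
      rintro _ ⟨w, hw, rfl⟩
      exact hmin w hw
    rw [dcross x hx' y hy', hm]
    exact ⟨z, hz, rfl, hmin⟩
  clear_value d
  have zero_cross : ∀ a ∈ X, ∀ b ∈ Y, d a b = 0 → a = b := fun a ha b hb h => by
    obtain ⟨z, hz, hd, -⟩ := dleast a ha b hb
    rw [hd] at h
    have h1 : a = z := (hX0 a ha z hz.1).1
      (le_antisymm (h ▸ le_max_left _ _) (nonnegX a ha z hz.1))
    have h2 : z = b := (hY0 z hz.2 b hb).1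
      (le_antisymm (h ▸ le_max_right _ _) (nonnegY z hz.2 b hb))
    exact h1.trans h2
  have triXXY : ∀ a ∈ X, ∀ b ∈ X, ∀ c ∈ Y, d a c ≤ max (d a b) (d b c) :=
    fun a ha b hb c hc => by
      obtain ⟨z, hz, hd, -⟩ := dleast b hb c hc
      obtain ⟨-, -, -, hle⟩ := dleast a ha c hc
      rw [hd, dXX a ha b hb, ← max_assoc]
      exact (hle z hz).trans (max_le_max_right _ (hXu a ha b hb z hz.1))
  have triXYY : ∀ a ∈ X, ∀ b ∈ Y, ∀ c ∈ Y, d a c ≤ max (d a b) (d b c) :=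
    fun a ha b hb c hc => by
      obtain ⟨z, hz, hd, -⟩ := dleast a ha b hb
      obtain ⟨-, -, -, hle⟩ := dleast a ha c hc
      rw [hd, dYY b hb c hc, max_assoc]
      exact (hle z hz).trans (max_le_max_left _ (hYu z hz.2 b hb c hc))
  have triXYX : ∀ a ∈ X, ∀ b ∈ Y, ∀ c ∈ X, d a c ≤ max (d a b) (d b c) :=
    fun a ha b hb c hc => by
      obtain ⟨z, hz, hd, -⟩ := dleast a ha b hb
      obtain ⟨w, hw, hd', -⟩ := dleast c hc b hb
      have h1 := hXu a ha z hz.1 c hc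
      have h2 := hXu z hz.1 w hw.1 c hc
      have h3 := hYu z hz.2 b hb w hw.2
      rw [hagree z hz w hw] at h2
      rw [hYs b hb w hw.2] at h3
      rw [hXs w hw.1 c hc] at h2
      rw [dsymm b c, hd, hd', dXX a ha c hc]
      clear * - h1 h2 h3
      grind
  have triYXY : ∀ a ∈ Y, ∀ b ∈ X, ∀ c ∈ Y, d a c ≤ max (d a b) (d b c) :=
    fun a ha b hb c hc => by
      obtain ⟨z, hz, hd, -⟩ := dleast b hb a ha
      obtain ⟨w, hw, hd', -⟩ := dleast b hb c hc
      have h1 := hYu a ha z hz.2 c hc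
      have h2 := hYu z hz.2 w hw.2 c hc
      have h3 := hXu z hz.1 b hb w hw.1
      rw [← hagree z hz w hw] at h2
      rw [hXs z hz.1 b hb] at h3
      rw [hYs a ha z hz.2] at h1
      rw [dsymm a b, hd, hd', dYY a ha c hc]
      clear * - h1 h2 h3
      grind
  refine ⟨d, dXX, dYY, fun x hx y hy => ⟨dcross x hx y hy, dsymm y x⟩, fun a b => ⟨?_, ?_⟩,
    dsymm, fun a b c => ?_⟩
  · intro h
    rcases cover a with ha | ha <;> rcases cover b with hb | hb
    · exact (hX0 a ha b hb).1 (dXX a ha b hb ▸ h)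
    · exact zero_cross a ha b hb h
    · exact (zero_cross b hb a ha (dsymm a b ▸ h)).symm
    · exact (hY0 a ha b hb).1 (dYY a ha b hb ▸ h)
  · rintro rfl
    rcases cover a with ha | ha
    · rw [dXX a ha a ha, (hX0 a ha a ha).2 rfl]
    · rw [dYY a ha a ha, (hY0 a ha a ha).2 rfl]
  · rcases cover a with ha | ha <;> rcases cover b with hb | hb <;> rcases cover c with hc | hc
    · rw [dXX a ha c hc, dXX a ha b hb, dXX b hb c hc]
      exact hXu a ha b hb c hc
    · exact triXXY a ha b hb c hc
    · exact triXYX a ha b hb c hc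
    · exact triXYY a ha b hb c hc
    · rw [dsymm a c, dsymm a b, dsymm b c, max_comm]
      exact triXXY c hc b hb a ha
    · exact triYXY a ha b hb c hc
    · rw [dsymm a c, dsymm a b, dsymm b c, max_comm]
      exact triXYY c hc b hb a ha
    · rw [dYY a ha c hc, dYY a ha b hb, dYY b hb c hc]
      exact hYu a ha b hb c hc
end

section
/- Every separable ultrametric space (X, d) admits an isometric embedding into a real Hilbert space: there exists a map f : X → ℓ²(ℕ; ℝ) such that ‖f(x) − f(y)‖ = d(x,y) for all x, y ∈ X. -/
open MeasureTheory TopologicalSpace Set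
open scoped symmDiff ENNReal

/-- An orthonormal family in a separable inner product space is countable. -/
theorem Orthonormal.countable_of_separableSpace {ι E : Type*} [NormedAddCommGroup E]
    [InnerProductSpace ℝ E] [SeparableSpace E] {v : ι → E} (hv : Orthonormal ℝ v) :
    Countable ι := by
  refine Pairwise.countable_of_isOpen_disjoint (s := fun i => Metric.ball (v i) (1 / 2)) ?_
    (fun i => Metric.isOpen_ball) (fun i => ⟨v i, Metric.mem_ball_self (by norm_num)⟩)
  intro i j hij
  refine Metric.ball_disjoint_ball ?_
  have h : ‖v i - v j‖ ^ 2 = 2 := by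
    rw [norm_sub_sq_real, hv.1 i, hv.1 j, hv.2 hij]
    norm_num
  rw [dist_eq_norm]
  nlinarith [norm_nonneg (v i - v j)]

/-- Every separable real Hilbert space embeds linearly and isometrically into `ℓ²(ℕ; ℝ)`. -/
theorem exists_linearIsometry_lp_nat (E : Type*) [NormedAddCommGroup E]
    [InnerProductSpace ℝ E] [CompleteSpace E] [SeparableSpace E] :
    Nonempty (E →ₗᵢ[ℝ] lp (fun _ : ℕ => ℝ) 2) := by
  obtain ⟨w, b, -⟩ := exists_hilbertBasis ℝ E
  have : Countable w := b.orthonormal.countable_of_separableSpace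
  obtain ⟨e, he⟩ := exists_injective_nat w
  have ho : Orthonormal ℝ (fun i : w => lp.single (E := fun _ : ℕ => ℝ) 2 (e i) (1 : ℝ)) := by
    refine ⟨fun i => ?_, fun i j hij => ?_⟩
    · rw [lp.norm_single (by norm_num)]
      simp
    · beta_reduce
      rw [lp.inner_single_left, lp.single_apply_ne _ _ _ (he.ne hij), inner_zero_right]
  exact ⟨ho.orthogonalFamily.linearIsometry.comp b.repr.toLinearIsometry⟩

/-- A family of sets whose symmetric differences have measure `dist x y ^ 2` yields an isometric
map into `L²`. -/
theorem exists_isometry_Lp_of_measure_symmDiff {X Ω : Type*} [PseudoMetricSpace X]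
    [MeasurableSpace Ω] {μ : Measure Ω} {A : X → Set Ω} (hA : ∀ x, MeasurableSet (A x))
    (hμ : ∀ x y, μ (A x ∆ A y) = ENNReal.ofReal (dist x y ^ 2)) :
    ∃ f : X → Lp ℝ 2 μ, Isometry f := by
  cases isEmpty_or_nonempty X with
  | inl h => exact ⟨fun x => h.elim x, fun x => h.elim x⟩
  | inr h =>
    obtain ⟨o⟩ := h
    let g (x : X) : Ω → ℝ := (A x).indicator 1
    have hg (x y : X) : eLpNorm (g x - g y) 2 μ = ENNReal.ofReal (dist x y) := by
      rw [eLpNorm_indicator_sub_indicator]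
      have := eLpNorm_indicator_const (μ := μ) (c := (1 : ℝ)) (p := 2) ((hA x).symmDiff (hA y))
        (by norm_num) (by norm_num)
      refine this.trans ?_
      rw [hμ, ENNReal.ofReal_rpow_of_nonneg (by positivity) (by norm_num), ENNReal.toReal_ofNat,
        ← Real.sqrt_eq_rpow, Real.sqrt_sq dist_nonneg]
      simp
    have hm (x y : X) : MemLp (g x - g y) 2 μ := by
      refine ⟨?_, by rw [hg]; exact ENNReal.ofReal_lt_top⟩
      exact ((measurable_one.indicator (hA x)).sub
        (measurable_one.indicator (hA y))).aestronglyMeasurable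
    refine ⟨fun x => (hm x o).toLp, Isometry.of_dist_eq fun x y => ?_⟩
    rw [dist_eq_norm, ← MemLp.toLp_sub, Lp.norm_toLp, sub_sub_sub_cancel_right, hg,
      ENNReal.toReal_ofReal dist_nonneg]

/-- `u n` is the first term of the sequence `u` within distance `r` of `x`. -/
def IsFirstWithin {X : Type*} [PseudoMetricSpace X] (u : ℕ → X) (x : X) (r : ℝ) (n : ℕ) : Prop :=
  dist x (u n) ≤ r ∧ ∀ m < n, r < dist x (u m)

namespace IsFirstWithin

variable {X : Type*} [PseudoMetricSpace X] {u : ℕ → X} {x y : X} {r : ℝ} {n m : ℕ}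

theorem eq (hn : IsFirstWithin u x r n) (hm : IsFirstWithin u x r m) : n = m := by
  rcases lt_trichotomy n m with h | h | h
  · exact absurd hn.1 (hm.2 n h).not_ge
  · exact h
  · exact absurd hm.1 (hn.2 m h).not_ge

theorem exists_of_denseRange (hu : DenseRange u) (x : X) (hr : 0 < r) :
    ∃ n, IsFirstWithin u x r n := by
  classical
  have h : ∃ n, dist x (u n) ≤ r := (hu.exists_dist_lt x hr).imp fun _ => le_of_lt
  exact ⟨Nat.find h, Nat.find_spec h, fun m hm => not_le.1 (Nat.find_min h hm)⟩

theorem of_dist_le [IsUltrametricDist X] (h : dist x y ≤ r) (hn : IsFirstWithin u x r n) :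
    IsFirstWithin u y r n := by
  refine ⟨?_, fun m hm => ?_⟩
  · exact (dist_triangle_max y x _).trans (max_le (dist_comm x y ▸ h) hn.1)
  · by_contra! hy
    exact (hn.2 m hm).not_ge ((dist_triangle_max x y _).trans (max_le h hy))

theorem dist_le [IsUltrametricDist X] (hx : IsFirstWithin u x r n)
    (hy : IsFirstWithin u y r n) : dist x y ≤ r :=
  (dist_triangle_max x (u n) y).trans (max_le hx.1 (dist_comm y (u n) ▸ hy.1))

end IsFirstWithin

/-- The pairs `(t, n)` with `t > 0` such that `u n` represents the closed ball of radius `√(2t)`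
around `x`. -/
def ballCode {X : Type*} [PseudoMetricSpace X] (u : ℕ → X) (x : X) : Set (ℝ × ℕ) :=
  {p | 0 < p.1 ∧ IsFirstWithin u x √(2 * p.1) p.2}

theorem measurableSet_ballCode {X : Type*} [PseudoMetricSpace X] (u : ℕ → X) (x : X) :
    MeasurableSet (ballCode u x) := by
  have hr : Measurable fun p : ℝ × ℕ => √(2 * p.1) := by fun_prop
  have hd : Measurable fun p : ℝ × ℕ => dist x (u p.2) :=
    (Measurable.of_discrete (f := fun n => dist x (u n))).comp measurable_snd
  refine (measurableSet_lt measurable_const measurable_fst).inter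
    ((measurableSet_le hd hr).inter ?_)
  change MeasurableSet {p : ℝ × ℕ | ∀ m < p.2, √(2 * p.1) < dist x (u m)}
  have h : {p : ℝ × ℕ | ∀ m < p.2, √(2 * p.1) < dist x (u m)} =
      ⋂ m, ({p : ℝ × ℕ | m < p.2}ᶜ ∪ {p | √(2 * p.1) < dist x (u m)}) := by
    ext p
    simp only [mem_iInter, mem_union, mem_compl_iff, mem_ofPred_eq, imp_iff_not_or]
  rw [h]
  exact MeasurableSet.iInter fun m => (measurableSet_lt measurable_const measurable_snd).compl.union
    (measurableSet_lt hr measurable_const)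

theorem count_symmDiff_ballCode {X : Type*} [PseudoMetricSpace X] [IsUltrametricDist X]
    {u : ℕ → X} (hu : DenseRange u) (x y : X) (t : ℝ) :
    Measure.count (Prod.mk t ⁻¹' (ballCode u x ∆ ballCode u y)) =
      (Ioo 0 (dist x y ^ 2 / 2)).indicator (fun _ => (2 : ℝ≥0∞)) t := by
  by_cases ht : 0 < t
  · by_cases h : dist x y ≤ √(2 * t)
    · have ht' : t ∉ Ioo 0 (dist x y ^ 2 / 2) := by
        rw [Real.le_sqrt dist_nonneg (by positivity)] at h
        exact fun h' => by linarith [h'.2]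
      have he : Prod.mk t ⁻¹' (ballCode u x ∆ ballCode u y) = ∅ := by
        ext n
        have : IsFirstWithin u x √(2 * t) n ↔ IsFirstWithin u y √(2 * t) n :=
          ⟨.of_dist_le h, .of_dist_le (dist_comm x y ▸ h)⟩
        simp only [ballCode, mem_preimage, mem_symmDiff, mem_ofPred_eq, this, and_not_self, or_self,
          mem_empty_iff_false]
      simp [he, ht']
    · have ht' : t ∈ Ioo 0 (dist x y ^ 2 / 2) := by
        rw [Real.le_sqrt dist_nonneg (by positivity)] at h
        exact ⟨ht, by linarith⟩
      have hr : 0 < √(2 * t) := by positivity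
      obtain ⟨a, ha⟩ := IsFirstWithin.exists_of_denseRange hu x hr
      obtain ⟨b, hb⟩ := IsFirstWithin.exists_of_denseRange hu y hr
      have hab : a ≠ b := by
        rintro rfl
        exact h (ha.dist_le hb)
      have hx (n : ℕ) : IsFirstWithin u x √(2 * t) n ↔ n = a := ⟨fun hn => hn.eq ha, (· ▸ ha)⟩
      have hy (n : ℕ) : IsFirstWithin u y √(2 * t) n ↔ n = b := ⟨fun hn => hn.eq hb, (· ▸ hb)⟩
      have he : Prod.mk t ⁻¹' (ballCode u x ∆ ballCode u y) = (({a, b} : Finset ℕ) : Set ℕ) := by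
        ext n
        simp only [ballCode, mem_preimage, mem_symmDiff, mem_ofPred_eq, ht, hx, hy, true_and,
          Finset.coe_insert, Finset.coe_singleton, mem_insert_iff, mem_singleton_iff]
        grind
      rw [he, Measure.count_apply_finset, Finset.card_pair hab, indicator_of_mem ht']
      norm_num
  · have he : Prod.mk t ⁻¹' (ballCode u x ∆ ballCode u y) = ∅ := by
      ext n
      simp [ballCode, ht]
    simp [he, ht]

theorem measure_symmDiff_ballCode {X : Type*} [PseudoMetricSpace X] [IsUltrametricDist X]
    {u : ℕ → X} (hu : DenseRange u) (x y : X) :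
    ((volume : Measure ℝ).prod Measure.count) (ballCode u x ∆ ballCode u y) =
      ENNReal.ofReal (dist x y ^ 2) := by
  rw [Measure.prod_apply ((measurableSet_ballCode u x).symmDiff (measurableSet_ballCode u y))]
  simp_rw [count_symmDiff_ballCode hu]
  rw [lintegral_indicator_const measurableSet_Ioo, Real.volume_Ioo,
    ← ENNReal.ofReal_ofNat 2, ← ENNReal.ofReal_mul (by norm_num)]
  congr 1
  ring

/-- Every separable ultrametric space admits an isometric embedding into the real
Hilbert space `ℓ²(ℕ; ℝ)`. -/
theorem separable_ultrametric_isometric_embedding_l2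
    (X : Type*) [MetricSpace X] [TopologicalSpace.SeparableSpace X]
    (hU : ∀ x y z : X, dist x z ≤ max (dist x y) (dist y z)) :
    ∃ f : X → lp (fun _ : ℕ => ℝ) 2, ∀ x y : X, ‖f x - f y‖ = dist x y := by
  have : IsUltrametricDist X := ⟨hU⟩
  cases isEmpty_or_nonempty X with
  | inl h => exact ⟨fun x => h.elim x, fun x => h.elim x⟩
  | inr h =>
    obtain ⟨f, hf⟩ := exists_isometry_Lp_of_measure_symmDiff
      (measurableSet_ballCode (denseSeq X)) (measure_symmDiff_ballCode (denseRange_denseSeq X))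
    have : Fact ((2 : ℝ≥0∞) ≠ ∞) := ⟨by norm_num⟩
    obtain ⟨g⟩ := exists_linearIsometry_lp_nat
      (Lp ℝ 2 ((volume : Measure ℝ).prod (Measure.count : Measure ℕ)))
    refine ⟨g ∘ f, fun x y => ?_⟩
    rw [← dist_eq_norm]
    exact (g.isometry.comp hf).dist_eq x y
end

section
/- Every separable ultrametric space (X, d) admits a map ψ : X → ℓ²(ℕ; ℝ) such that ‖ψ(x) − ψ(y)‖² = d(x,y) for all x, y ∈ X. -/
open MeasureTheory Set

/-- A separable real Hilbert space embeds linearly and isometrically into `ℓ²(ℕ; ℝ)`. -/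
theorem exists_linearIsometry_to_l2 (E : Type*) [NormedAddCommGroup E] [InnerProductSpace ℝ E]
    [CompleteSpace E] [TopologicalSpace.SeparableSpace E] :
    Nonempty (E →ₗᵢ[ℝ] lp (fun _ : ℕ => ℝ) 2) := by
  classical
  obtain ⟨w, b, -⟩ := exists_hilbertBasis ℝ E
  have hsep : Pairwise fun i j : w => 1 ≤ dist (b i) (b j) := by
    intro i j hij
    have h := norm_sub_sq_real (b i) (b j)
    rw [b.orthonormal.1, b.orthonormal.1, b.orthonormal.2 hij] at h
    rw [dist_eq_norm]
    nlinarith [norm_nonneg (b i - b j)]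
  have hc : Countable w := by
    refine Pairwise.countable_of_isOpen_disjoint
      (s := fun i : w => Metric.ball (b i) (1 / 2)) ?_ (fun _ => Metric.isOpen_ball)
      (fun i => ⟨b i, Metric.mem_ball_self (by norm_num)⟩)
    intro i j hij
    exact Metric.ball_disjoint_ball (by linarith [hsep hij])
  obtain ⟨e, he⟩ := exists_injective_nat w
  have ho : Orthonormal ℝ (fun i : ℕ => (lp.single 2 i (1 : ℝ) : lp (fun _ : ℕ => ℝ) 2)) := by
    rw [orthonormal_iff_ite]
    intro i j
    rw [lp.inner_single_left]
    simp [lp.single_apply, Pi.single_apply]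
  have hv := (ho.comp e he).orthogonalFamily
  exact ⟨hv.linearIsometry.comp b.repr.toLinearIsometry⟩

theorem eLpNorm_indicator_sub_indicator {α : Type*} [MeasurableSpace α] (μ : Measure α)
    {A B : Set α} (hA : MeasurableSet A) (hB : MeasurableSet B) :
    eLpNorm (A.indicator (fun _ => (1 : ℝ)) - B.indicator (fun _ => (1 : ℝ))) 2 μ =
      μ (symmDiff A B) ^ (1 / 2 : ℝ) := by
  have h : eLpNorm (A.indicator (fun _ => (1 : ℝ)) - B.indicator (fun _ => (1 : ℝ))) 2 μ =
      eLpNorm ((symmDiff A B).indicator (fun _ => (1 : ℝ))) 2 μ := by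
    refine eLpNorm_congr_norm_ae (.of_forall fun a => ?_)
    by_cases ha : a ∈ A <;> by_cases hb : a ∈ B <;> simp [ha, hb, mem_symmDiff]
  rw [h, eLpNorm_indicator_const (hA.symmDiff hB) (by simp) (by simp)]
  simp

/-- The points `(s, n)` such that `u n` is the first term of `u` at distance less than `s`
from `x`. -/
def firstCloseIndex {X : Type*} [MetricSpace X] (u : ℕ → X) (x : X) : Set (ℝ × ℕ) :=
  {p | dist x (u p.2) < p.1 ∧ ∀ m < p.2, p.1 ≤ dist x (u m)}

section

variable {X : Type*} [MetricSpace X] {u : ℕ → X}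

theorem measurableSet_firstCloseIndex (x : X) : MeasurableSet (firstCloseIndex u x) := by
  have h : firstCloseIndex u x =
      ⋃ n, (Ioi (dist x (u n)) ∩ ⋂ m, ⋂ (_ : m < n), Iic (dist x (u m))) ×ˢ {n} := by
    ext ⟨s, n⟩
    simp [firstCloseIndex]
  rw [h]
  refine .iUnion fun n => .prod (measurableSet_Ioi.inter ?_) (measurableSet_singleton n)
  exact .iInter fun m => .iInter fun _ => measurableSet_Iic

theorem exists_section_firstCloseIndex (hu : DenseRange u) (x : X) {s : ℝ} (hs : 0 < s) :
    ∃ n, dist x (u n) < s ∧ Prod.mk s ⁻¹' firstCloseIndex u x = {n} := by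
  classical
  have h := hu.exists_dist_lt x hs
  refine ⟨Nat.find h, Nat.find_spec h, ?_⟩
  ext n
  simp only [firstCloseIndex, mem_preimage, mem_ofPred_eq, mem_singleton_iff]
  rw [eq_comm, Nat.find_eq_iff]
  simp only [not_lt]

theorem section_firstCloseIndex_of_nonpos (x : X) {s : ℝ} (hs : s ≤ 0) :
    Prod.mk s ⁻¹' firstCloseIndex u x = ∅ := by
  ext n
  simp only [firstCloseIndex, mem_preimage, mem_ofPred_eq, mem_empty_iff_false, iff_false]
  intro h
  linarith [h.1, dist_nonneg (x := x) (y := u n)]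

theorem section_firstCloseIndex_congr
    (hU : ∀ x y z : X, dist x z ≤ max (dist x y) (dist y z)) {x y : X} {s : ℝ}
    (hs : dist x y < s) :
    Prod.mk s ⁻¹' firstCloseIndex u x = Prod.mk s ⁻¹' firstCloseIndex u y := by
  have h (n : ℕ) : dist x (u n) < s ↔ dist y (u n) < s :=
    ⟨fun hn => (hU y x _).trans_lt (max_lt (by rwa [dist_comm]) hn),
      fun hn => (hU x y _).trans_lt (max_lt hs hn)⟩
  ext n
  simp only [firstCloseIndex, mem_preimage, mem_ofPred_eq, ← not_lt, h]

theorem measure_symmDiff_firstCloseIndex (hu : DenseRange u)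
    (hU : ∀ x y z : X, dist x z ≤ max (dist x y) (dist y z)) (x y : X) :
    (volume.prod Measure.count) (symmDiff (firstCloseIndex u x) (firstCloseIndex u y)) =
      2 * ENNReal.ofReal (dist x y) := by
  rw [Measure.prod_apply
    ((measurableSet_firstCloseIndex x).symmDiff (measurableSet_firstCloseIndex y))]
  have h (s : ℝ) : Measure.count
      (Prod.mk s ⁻¹' symmDiff (firstCloseIndex u x) (firstCloseIndex u y)) =
      (Ioc 0 (dist x y)).indicator (fun _ => (2 : ENNReal)) s := by
    rw [preimage_symmDiff]
    rcases le_or_gt s 0 with hs | hs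
    · rw [section_firstCloseIndex_of_nonpos x hs, section_firstCloseIndex_of_nonpos y hs,
        indicator_of_notMem (fun h => h.1.not_ge hs)]
      simp
    rcases lt_or_ge (dist x y) s with hd | hd
    · rw [section_firstCloseIndex_congr hU hd, indicator_of_notMem (fun h => h.2.not_gt hd)]
      simp
    · obtain ⟨m, hm, hm'⟩ := exists_section_firstCloseIndex hu x hs
      obtain ⟨n, hn, hn'⟩ := exists_section_firstCloseIndex hu y hs
      have hmn : m ≠ n := by
        rintro rfl
        exact hd.not_gt ((hU x (u m) y).trans_lt (max_lt hm (by rwa [dist_comm])))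
      rw [hm', hn', indicator_of_mem (show s ∈ Ioc 0 (dist x y) from ⟨hs, hd⟩),
        (disjoint_singleton.2 hmn).symmDiff_eq_sup]
      change Measure.count ({m} ∪ {n} : Set ℕ) = 2
      rw [measure_union (disjoint_singleton.2 hmn) (measurableSet_singleton n),
        Measure.count_singleton, Measure.count_singleton, one_add_one_eq_two]
  simp_rw [h]
  rw [lintegral_indicator_const measurableSet_Ioc, Real.volume_Ioc, sub_zero]

theorem eLpNorm_firstCloseIndex_sub (hu : DenseRange u)
    (hU : ∀ x y z : X, dist x z ≤ max (dist x y) (dist y z)) (x y : X) :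
    eLpNorm ((firstCloseIndex u x).indicator (fun _ => (1 : ℝ)) -
      (firstCloseIndex u y).indicator (fun _ => (1 : ℝ))) 2 (volume.prod Measure.count) =
      (2 * ENNReal.ofReal (dist x y)) ^ (1 / 2 : ℝ) := by
  rw [eLpNorm_indicator_sub_indicator _ (measurableSet_firstCloseIndex x)
    (measurableSet_firstCloseIndex y), measure_symmDiff_firstCloseIndex hu hU]

theorem memLp_firstCloseIndex_sub (hu : DenseRange u)
    (hU : ∀ x y z : X, dist x z ≤ max (dist x y) (dist y z)) (x y : X) :
    MemLp ((firstCloseIndex u x).indicator (fun _ => (1 : ℝ)) -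
      (firstCloseIndex u y).indicator (fun _ => (1 : ℝ))) 2 (volume.prod Measure.count) := by
  refine ⟨((measurable_const.indicator (measurableSet_firstCloseIndex x)).sub
    (measurable_const.indicator (measurableSet_firstCloseIndex y))).aestronglyMeasurable, ?_⟩
  rw [eLpNorm_firstCloseIndex_sub hu hU]
  exact ENNReal.rpow_lt_top_of_nonneg (by norm_num)
    (ENNReal.mul_ne_top (by simp) ENNReal.ofReal_ne_top)

end

/-- Every separable ultrametric space admits a map `ψ` to the real Hilbert space
`ℓ²(ℕ; ℝ)` such that `‖ψ x − ψ y‖² = d(x,y)` for all `x, y`. -/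
theorem separable_ultrametric_square_embedding_l2
    (X : Type*) [MetricSpace X] [TopologicalSpace.SeparableSpace X]
    (hU : ∀ x y z : X, dist x z ≤ max (dist x y) (dist y z)) :
    ∃ ψ : X → lp (fun _ : ℕ => ℝ) 2, ∀ x y : X, ‖ψ x - ψ y‖ ^ 2 = dist x y := by
  rcases isEmpty_or_nonempty X with hX | ⟨⟨o⟩⟩
  · exact ⟨fun _ => 0, fun x => isEmptyElim x⟩
  have : Nonempty X := ⟨o⟩
  obtain ⟨u, hu⟩ := TopologicalSpace.exists_dense_seq X
  have : Fact ((2 : ENNReal) ≠ ⊤) := ⟨by simp⟩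
  obtain ⟨T⟩ := exists_linearIsometry_to_l2
    (Lp ℝ 2 ((volume : Measure ℝ).prod (Measure.count : Measure ℕ)))
  refine ⟨fun x => T ((√2)⁻¹ • (memLp_firstCloseIndex_sub hu hU x o).toLp), fun x y => ?_⟩
  rw [← map_sub, T.norm_map, ← smul_sub, norm_smul, mul_pow, ← MemLp.toLp_sub, Lp.norm_toLp,
    sub_sub_sub_cancel_right, eLpNorm_firstCloseIndex_sub hu hU, ← ENNReal.toReal_rpow,
    ← Real.sqrt_eq_rpow, Real.sq_sqrt ENNReal.toReal_nonneg]
  simp [ENNReal.toReal_ofReal dist_nonneg]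
end

section
/- Let (X, d) be an ultrametric space and let s be a real number with 0 < s < 1. Then the kernel K(x,y) = s^{d(x,y)} is positive semidefinite on X: for every n ∈ ℕ, all points x₁, …, xₙ ∈ X and all real numbers c₁, …, cₙ, one has ∑_{i=1}^{n} ∑_{j=1}^{n} c_i c_j s^{d(x_i, x_j)} ≥ 0. -/
/-- The indicator kernel of an equivalence relation is positive semidefinite. -/
theorem Setoid.sum_sum_mul_indicator_nonneg {ι : Type*} [Fintype ι] (r : Setoid ι)
    [DecidableRel r] (c : ι → ℝ) :
    0 ≤ ∑ i, ∑ j, c i * c j * (if r i j then 1 else 0) := by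
  classical
  have h : ∑ i, ∑ j, c i * c j * (if r i j then (1 : ℝ) else 0) =
      ∑ q : Quotient r, (∑ i, if Quotient.mk r i = q then c i else 0) ^ 2 := by
    simp_rw [sq, Finset.sum_mul_sum]
    refine Eq.symm <| Finset.sum_comm.trans <| Finset.sum_congr rfl fun i _ => ?_
    refine Finset.sum_comm.trans <| Finset.sum_congr rfl fun j _ => ?_
    simp only [ite_mul, zero_mul, Finset.sum_ite_eq, Finset.mem_univ, if_true, mul_ite,
      mul_one, mul_zero]
    exact if_congr Quotient.eq rfl rfl
  rw [h]
  positivity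

open MeasureTheory in
/-- A symmetric kernel with values in `[0, 1]`, equal to `1` on the diagonal and satisfying
`min (k i j) (k j l) ≤ k i l`, is positive semidefinite: it is an average of the indicator kernels
of the equivalence relations `t ≤ k i j`, for `t ∈ (0, 1]`. -/
theorem sum_sum_mul_nonneg_of_min_le {ι : Type*} [Fintype ι] (k : ι → ι → ℝ)
    (hk0 : ∀ i j, 0 ≤ k i j) (hk1 : ∀ i j, k i j ≤ 1) (hdiag : ∀ i, k i i = 1)
    (hsymm : ∀ i j, k i j = k j i) (hmin : ∀ i j l, min (k i j) (k j l) ≤ k i l) (c : ι → ℝ) :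
    0 ≤ ∑ i, ∑ j, c i * c j * k i j := by
  classical
  have hint (a : ℝ) : IntegrableOn ((Set.Iic a).indicator fun _ => (1 : ℝ)) (Set.Ioc 0 1) :=
    (integrable_const 1).indicator measurableSet_Iic
  have hval (i j : ι) :
      ∫ t in Set.Ioc (0 : ℝ) 1, (Set.Iic (k i j)).indicator (fun _ => (1 : ℝ)) t = k i j := by
    rw [setIntegral_indicator measurableSet_Iic, Set.Ioc_inter_Iic, min_eq_right (hk1 i j)]
    simp [hk0 i j]
  have h : ∑ i, ∑ j, c i * c j * k i j = ∫ t in Set.Ioc (0 : ℝ) 1,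
      ∑ i, ∑ j, c i * c j * (Set.Iic (k i j)).indicator (fun _ => (1 : ℝ)) t := by
    rw [integral_finsetSum _ fun i _ => integrable_finsetSum _ fun j _ => (hint _).const_mul _]
    refine Finset.sum_congr rfl fun i _ => ?_
    rw [integral_finsetSum _ fun j _ => (hint _).const_mul _]
    refine Finset.sum_congr rfl fun j _ => ?_
    rw [integral_const_mul, hval]
  rw [h]
  refine setIntegral_nonneg measurableSet_Ioc fun t ht => ?_
  let r : Setoid ι :=
    { r := fun i j => t ≤ k i j
      iseqv :=
        { refl := fun i => (hdiag i).symm ▸ ht.2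
          symm := fun {i j} hij => hsymm i j ▸ hij
          trans := fun {i j l} hij hjl => (le_min hij hjl).trans (hmin i j l) } }
  simp only [Set.indicator_apply, Set.mem_Iic]
  exact r.sum_sum_mul_indicator_nonneg c

/-- For an ultrametric space `(X, d)` and `0 < s < 1`, the kernel
`K(x,y) = s ^ d(x,y)` is positive semidefinite on `X`. -/
theorem ultrametric_kernel_positive_semidefinite
    (X : Type*) [MetricSpace X]
    (hU : ∀ x y z : X, dist x z ≤ max (dist x y) (dist y z))
    (s : ℝ) (hs0 : 0 < s) (hs1 : s < 1) :
    ∀ (n : ℕ) (x : Fin n → X) (c : Fin n → ℝ),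
      0 ≤ ∑ i : Fin n, ∑ j : Fin n, c i * c j * s ^ dist (x i) (x j) := by
  intro n x c
  refine sum_sum_mul_nonneg_of_min_le (fun i j => s ^ dist (x i) (x j))
    (fun i j => by positivity) (fun i j => Real.rpow_le_one hs0.le hs1.le dist_nonneg)
    (fun i => by simp) (fun i j => by simp only [dist_comm]) (fun i j l => ?_) c
  rw [← (Real.antitone_rpow_of_base_le_one hs0 hs1.le).map_max]
  exact Real.rpow_le_rpow_of_exponent_ge hs0 hs1.le (hU _ _ _)
end

section
/- Let H and H′ be real Hilbert spaces, S a nonempty set, and φ : S → H, φ′ : S → H′ maps such that ‖φ(x) − φ(y)‖_H = ‖φ′(x) − φ′(y)‖_{H′} for all x, y ∈ S. Assume that no proper closed affine subspace of H contains φ(S), and that no proper closed affine subspace of H′ contains φ′(S). Then there exists a unique bijective affine isometry R : H → H′ such that R(φ(x)) = φ′(x) for all x ∈ S. -/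
open scoped InnerProductSpace

lemma AffineSubspace.denseRange_linearCombination_sub {E S : Type*} [NormedAddCommGroup E]
    [NormedSpace ℝ E] (φ : S → E) (x₀ : S)
    (hfull : ∀ A : AffineSubspace ℝ E, IsClosed (A : Set E) → Set.range φ ⊆ A → A = ⊤) :
    DenseRange (Finsupp.linearCombination ℝ fun x => φ x - φ x₀) := by
  set L := Finsupp.linearCombination ℝ fun x => φ x - φ x₀
  set K : Submodule ℝ E := L.range.topologicalClosure
  have hK : AffineSubspace.mk' (φ x₀) K = ⊤ := by
    apply hfull
    · have hpre : (AffineSubspace.mk' (φ x₀) K : Set E) = (fun y => y - φ x₀) ⁻¹' (K : Set E) := by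
        ext y
        simp [AffineSubspace.mem_mk']
      rw [hpre]
      exact L.range.isClosed_topologicalClosure.preimage (by fun_prop)
    · rintro _ ⟨x, rfl⟩
      rw [SetLike.mem_coe, AffineSubspace.mem_mk', vsub_eq_sub]
      exact L.range.le_topologicalClosure ⟨Finsupp.single x 1, by simp [L]⟩
  intro y
  have hy : y + φ x₀ ∈ AffineSubspace.mk' (φ x₀) K := hK ▸ AffineSubspace.mem_top ℝ E _
  rw [AffineSubspace.mem_mk', vsub_eq_sub, add_sub_cancel_right] at hy
  rwa [← SetLike.mem_coe, Submodule.topologicalClosure_coe, LinearMap.coe_range] at hy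

lemma inner_sub_sub_eq_of_norm_sub_eq {E F S : Type*} [NormedAddCommGroup E]
    [InnerProductSpace ℝ E] [NormedAddCommGroup F] [InnerProductSpace ℝ F] {φ : S → E} {ψ : S → F}
    (hdist : ∀ x y : S, ‖φ x - φ y‖ = ‖ψ x - ψ y‖) (x y z : S) :
    ⟪φ x - φ z, φ y - φ z⟫_ℝ = ⟪ψ x - ψ z, ψ y - ψ z⟫_ℝ := by
  simp only [real_inner_eq_norm_mul_self_add_norm_mul_self_sub_norm_sub_mul_self_div_two,
    sub_sub_sub_cancel_right, hdist]

lemma norm_linearCombination_eq_of_inner_eq {E F S : Type*} [NormedAddCommGroup E]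
    [InnerProductSpace ℝ E] [NormedAddCommGroup F] [InnerProductSpace ℝ F] {u : S → E} {v : S → F}
    (h : ∀ x y : S, ⟪u x, u y⟫_ℝ = ⟪v x, v y⟫_ℝ) (c : S →₀ ℝ) :
    ‖Finsupp.linearCombination ℝ u c‖ = ‖Finsupp.linearCombination ℝ v c‖ := by
  rw [norm_eq_sqrt_real_inner, norm_eq_sqrt_real_inner]
  simp only [Finsupp.linearCombination_apply, Finsupp.sum, sum_inner, inner_sum,
    real_inner_smul_left, real_inner_smul_right, h]

lemma IsometryEquiv.ext_of_affine_full {E F S : Type*} [NormedAddCommGroup E]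
    [NormedSpace ℝ E] [NormedAddCommGroup F] [NormedSpace ℝ F] {φ : S → E}
    (hfull : ∀ A : AffineSubspace ℝ E, IsClosed (A : Set E) → Set.range φ ⊆ A → A = ⊤)
    {R T : E ≃ᵢ F} (h : ∀ x, R (φ x) = T (φ x)) : R = T := by
  let g : E →ᵃ[ℝ] F := R.toRealAffineIsometryEquiv.toAffineEquiv.toAffineMap -
    T.toRealAffineIsometryEquiv.toAffineEquiv.toAffineMap
  have hg : ∀ y, g y = R y - T y := fun y => rfl
  let A : AffineSubspace ℝ E := (⊥ : Submodule ℝ F).toAffineSubspace.comap g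
  have hmem : ∀ y, y ∈ A ↔ R y = T y := fun y => by
    simp [A, AffineSubspace.mem_comap, hg, sub_eq_zero]
  have hA : A = ⊤ := by
    apply hfull
    · have hset : (A : Set E) = {y | R y = T y} := Set.ext hmem
      rw [hset]
      exact isClosed_eq R.continuous T.continuous
    · rintro _ ⟨x, rfl⟩
      exact (hmem _).2 (h x)
  ext y
  exact (hmem y).1 (hA ▸ AffineSubspace.mem_top ℝ E y)

/-- Rigidity of distance-preserving maps with affinely spanning image:
if `φ : S → H` and `φ′ : S → H′` (real Hilbert spaces) satisfy
`‖φ x − φ y‖ = ‖φ′ x − φ′ y‖` for all `x, y`, and no proper closed affine subspace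
contains the image on either side, then there is a unique bijective (affine) isometry
`R : H → H′` with `R (φ x) = φ′ x` for all `x`. -/
theorem unique_affine_isometry_matching_distance_systems
    (H : Type*) [NormedAddCommGroup H] [InnerProductSpace ℝ H] [CompleteSpace H]
    (H' : Type*) [NormedAddCommGroup H'] [InnerProductSpace ℝ H'] [CompleteSpace H']
    (S : Type*) [Nonempty S] (φ : S → H) (φ' : S → H')
    (hdist : ∀ x y : S, ‖φ x - φ y‖ = ‖φ' x - φ' y‖)
    (hfull : ∀ A : AffineSubspace ℝ H, IsClosed (A : Set H) → Set.range φ ⊆ A → A = ⊤)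
    (hfull' : ∀ A : AffineSubspace ℝ H', IsClosed (A : Set H') → Set.range φ' ⊆ A → A = ⊤) :
    ∃! R : H ≃ᵢ H', ∀ x : S, R (φ x) = φ' x := by
  obtain ⟨x₀⟩ := ‹Nonempty S›
  let U : H ≃ₗᵢ[ℝ] H' := (LinearEquiv.refl ℝ (S →₀ ℝ)).extendOfIsometry
    (Finsupp.linearCombination ℝ fun x => φ x - φ x₀)
    (Finsupp.linearCombination ℝ fun x => φ' x - φ' x₀)
    (AffineSubspace.denseRange_linearCombination_sub φ x₀ hfull)
    (AffineSubspace.denseRange_linearCombination_sub φ' x₀ hfull')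
    (fun c => (norm_linearCombination_eq_of_inner_eq
      (fun x y => inner_sub_sub_eq_of_norm_sub_eq hdist x y x₀) c).symm)
  have hU : ∀ x, U (φ x - φ x₀) = φ' x - φ' x₀ := fun x => by
    simpa using LinearEquiv.extendOfIsometry_eq (LinearEquiv.refl ℝ (S →₀ ℝ)) _ _
      (AffineSubspace.denseRange_linearCombination_sub φ x₀ hfull)
      (AffineSubspace.denseRange_linearCombination_sub φ' x₀ hfull')
      (fun c => (norm_linearCombination_eq_of_inner_eq
        (fun x y => inner_sub_sub_eq_of_norm_sub_eq hdist x y x₀) c).symm)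
      (Finsupp.single x 1)
  let R : H ≃ᵢ H' := ((IsometryEquiv.subRight (φ x₀)).trans U.toIsometryEquiv).trans
    (IsometryEquiv.addRight (φ' x₀))
  have hR : ∀ x, R (φ x) = φ' x := fun x => by
    change U (φ x - φ x₀) + φ' x₀ = φ' x
    rw [hU, sub_add_cancel]
  exact ⟨R, hR, fun T hT => IsometryEquiv.ext_of_affine_full hfull fun x =>
    (hT x).trans (hR x).symm⟩
end

section
/- Let Λ ⊆ (0,∞) and let M_Λ be the set of functions ω : Λ → ℤ such that for every ε > 0 the set {λ ∈ Λ : λ ≥ ε and ω(λ) ≠ 0} is finite. Then: (1) for any two distinct ω, ω′ ∈ M_Λ the set {λ ∈ Λ : ω(λ) ≠ ω′(λ)} is nonempty and has a greatest element; (2) setting d(ω, ω′) equal to this greatest element when ω ≠ ω′ and d(ω, ω) = 0, the pair (M_Λ, d) is an ultrametric space, i.e. d is a metric satisfying d(ω, ω″) ≤ max(d(ω, ω′), d(ω′, ω″)) for all ω, ω′, ω″; (3) every nonzero distance d(ω, ω′) lies in Λ, and every element of Λ occurs as a distance, so the spectrum of (M_Λ, d) equals Λ. -/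
/-- The model `M_Λ` of the ultrametric Urysohn space: functions `ω : Λ → ℤ` such that for
every `ε > 0` the set of `λ ∈ Λ` with `λ ≥ ε` and `ω(λ) ≠ 0` is finite. -/
abbrev UrysohnPt (Λ : Set ℝ) : Type :=
  {ω : Λ → ℤ // ∀ ε : ℝ, 0 < ε → {l : Λ | ε ≤ (l : ℝ) ∧ ω l ≠ 0}.Finite}

/-- The distance on `M_Λ`: the largest `λ ∈ Λ` at which the two functions differ
(`sSup ∅ = 0` in Mathlib, so `uDist ω ω = 0`). -/
noncomputable def uDist {Λ : Set ℝ} (ω ω' : UrysohnPt Λ) : ℝ :=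
  sSup ((fun l : Λ => (l : ℝ)) '' {l : Λ | ω.1 l ≠ ω'.1 l})

namespace UrysohnPt

variable {Λ : Set ℝ}

theorem exists_greatest_ne (hΛ : ∀ r ∈ Λ, 0 < r) {ω ω' : UrysohnPt Λ} (h : ω ≠ ω') :
    ∃ l : Λ, ω.1 l ≠ ω'.1 l ∧ ∀ l' : Λ, ω.1 l' ≠ ω'.1 l' → (l' : ℝ) ≤ (l : ℝ) := by
  obtain ⟨l₀, h₀⟩ : ∃ l, ω.1 l ≠ ω'.1 l := Function.ne_iff.mp (Subtype.coe_ne_coe.mpr h)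
  have hfin : {l : Λ | (l₀ : ℝ) ≤ l ∧ ω.1 l ≠ ω'.1 l}.Finite := by
    refine ((ω.2 l₀ (hΛ l₀ l₀.2)).union (ω'.2 l₀ (hΛ l₀ l₀.2))).subset ?_
    rintro l ⟨hl, hne⟩
    by_cases hω : ω.1 l = 0
    · exact Or.inr ⟨hl, fun hω' => hne (hω.trans hω'.symm)⟩
    · exact Or.inl ⟨hl, hω⟩
  obtain ⟨l, ⟨hl, hne⟩, hmax⟩ :=
    Set.exists_max_image _ (fun l : Λ => (l : ℝ)) hfin ⟨l₀, le_rfl, h₀⟩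
  refine ⟨l, hne, fun l' hl' => ?_⟩
  rcases le_total (l₀ : ℝ) l' with h' | h'
  · exact hmax l' ⟨h', hl'⟩
  · exact h'.trans hl

theorem uDist_eq_of_greatest {ω ω' : UrysohnPt Λ} {l : Λ} (hne : ω.1 l ≠ ω'.1 l)
    (hmax : ∀ l' : Λ, ω.1 l' ≠ ω'.1 l' → (l' : ℝ) ≤ (l : ℝ)) : uDist ω ω' = l :=
  IsGreatest.csSup_eq ⟨⟨l, hne, rfl⟩, by rintro _ ⟨l', hl', rfl⟩; exact hmax l' hl'⟩

theorem uDist_self (ω : UrysohnPt Λ) : uDist ω ω = 0 := by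
  simp [uDist]

theorem uDist_comm (ω ω' : UrysohnPt Λ) : uDist ω ω' = uDist ω' ω := by
  simp only [uDist, ne_comm]

theorem uDist_nonneg (hΛ : ∀ r ∈ Λ, 0 < r) (ω ω' : UrysohnPt Λ) : 0 ≤ uDist ω ω' :=
  Real.sSup_nonneg (by rintro _ ⟨l, -, rfl⟩; exact (hΛ l l.2).le)

theorem le_uDist (hΛ : ∀ r ∈ Λ, 0 < r) {ω ω' : UrysohnPt Λ} {l : Λ} (h : ω.1 l ≠ ω'.1 l) :
    (l : ℝ) ≤ uDist ω ω' := by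
  obtain ⟨m, hne, hmax⟩ := exists_greatest_ne hΛ (ω := ω) (ω' := ω') (by rintro rfl; exact h rfl)
  exact (hmax l h).trans_eq (uDist_eq_of_greatest hne hmax).symm

theorem uDist_le_max (hΛ : ∀ r ∈ Λ, 0 < r) (ω ω' ω'' : UrysohnPt Λ) :
    uDist ω ω'' ≤ max (uDist ω ω') (uDist ω' ω'') := by
  refine Real.sSup_le ?_ (le_max_of_le_left (uDist_nonneg hΛ ω ω'))
  rintro _ ⟨l, hl, rfl⟩
  by_cases h : ω.1 l = ω'.1 l
  · exact le_max_of_le_right (le_uDist hΛ fun h' => hl (h.trans h'))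
  · exact le_max_of_le_left (le_uDist hΛ h)

theorem exists_uDist_eq (l : Λ) : ∃ ω ω' : UrysohnPt Λ, uDist ω ω' = l := by
  classical
  refine ⟨⟨Pi.single l 1, fun ε _ => (Set.finite_singleton l).subset ?_⟩,
    ⟨0, fun ε _ => by simp⟩, uDist_eq_of_greatest (by simp) fun l' hl' => ?_⟩
  · rintro m ⟨-, hm⟩
    by_contra hml
    exact hm (Pi.single_eq_of_ne hml 1)
  · by_contra hlt
    exact hl' (Pi.single_eq_of_ne (by rintro rfl; exact hlt le_rfl) 1)

end UrysohnPt

/-- For `Λ ⊆ (0,∞)`: (1) for distinct `ω, ω' ∈ M_Λ` the set of `λ` where they differ has a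
greatest element, which equals `uDist ω ω'`; (2) `uDist` is an ultrametric on `M_Λ`;
(3) the spectrum of `(M_Λ, uDist)` is exactly `Λ`. -/
theorem urysohnSpace_is_ultrametric_with_spectrum
    (Λ : Set ℝ) (hΛ : ∀ r ∈ Λ, 0 < r) :
    (∀ ω ω' : UrysohnPt Λ, ω ≠ ω' →
      ∃ l : Λ, ω.1 l ≠ ω'.1 l ∧ (∀ l' : Λ, ω.1 l' ≠ ω'.1 l' → (l' : ℝ) ≤ (l : ℝ)) ∧
        uDist ω ω' = (l : ℝ)) ∧
    (∀ ω ω' : UrysohnPt Λ, (uDist ω ω' = 0 ↔ ω = ω')) ∧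
    (∀ ω ω' : UrysohnPt Λ, uDist ω ω' = uDist ω' ω) ∧
    (∀ ω ω' ω'' : UrysohnPt Λ, uDist ω ω'' ≤ max (uDist ω ω') (uDist ω' ω'')) ∧
    (∀ ω ω' : UrysohnPt Λ, ω ≠ ω' → uDist ω ω' ∈ Λ) ∧
    (∀ r ∈ Λ, ∃ ω ω' : UrysohnPt Λ, uDist ω ω' = r) := by
  have key (ω ω' : UrysohnPt Λ) (h : ω ≠ ω') :
      ∃ l : Λ, ω.1 l ≠ ω'.1 l ∧ (∀ l' : Λ, ω.1 l' ≠ ω'.1 l' → (l' : ℝ) ≤ (l : ℝ)) ∧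
        uDist ω ω' = (l : ℝ) := by
    obtain ⟨l, hne, hmax⟩ := UrysohnPt.exists_greatest_ne hΛ h
    exact ⟨l, hne, hmax, UrysohnPt.uDist_eq_of_greatest hne hmax⟩
  refine ⟨key, fun ω ω' => ⟨fun h => ?_, ?_⟩, UrysohnPt.uDist_comm, UrysohnPt.uDist_le_max hΛ,
    fun ω ω' h => ?_, fun r hr => UrysohnPt.exists_uDist_eq ⟨r, hr⟩⟩
  · by_contra hne
    obtain ⟨l, -, -, hl⟩ := key ω ω' hne
    exact (hΛ l l.2).ne' (hl.symm.trans h)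
  · rintro rfl
    exact UrysohnPt.uDist_self ω
  · obtain ⟨l, -, -, hl⟩ := key ω ω' h
    exact hl ▸ l.2
end

section
/- Let Λ ⊆ (0,∞) be countable. Then the ultrametric space (M_Λ, d) is a complete metric space. -/
theorem bddAbove_uDist {Λ : Set ℝ} (ω ω' : UrysohnPt Λ) :
    BddAbove ((fun l : Λ => (l : ℝ)) '' {l : Λ | ω.1 l ≠ ω'.1 l}) := by
  have hfin := ((ω.2 1 one_pos).union (ω'.2 1 one_pos)).image (fun l : Λ => (l : ℝ))
  refine ((bddAbove_Iic (a := (1 : ℝ))).union hfin.bddAbove).mono ?_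
  rintro _ ⟨l, hl, rfl⟩
  rcases le_total (l : ℝ) 1 with h | h
  · exact Or.inl h
  · refine Or.inr ⟨l, ?_, rfl⟩
    by_cases h0 : ω.1 l = 0
    · exact Or.inr ⟨h, fun h1 => hl (h0.trans h1.symm)⟩
    · exact Or.inl ⟨h, h0⟩

theorem eq_of_uDist_lt {Λ : Set ℝ} {ω ω' : UrysohnPt Λ} {ε : ℝ} (h : uDist ω ω' < ε)
    {l : Λ} (hl : ε ≤ l) : ω.1 l = ω'.1 l := by
  by_contra hne
  exact (h.trans_le hl).not_ge (le_csSup (bddAbove_uDist ω ω') ⟨l, hne, rfl⟩)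

theorem uDist_le_of_forall_eq {Λ : Set ℝ} {ω ω' : UrysohnPt Λ} {ε : ℝ} (hε : 0 ≤ ε)
    (h : ∀ l : Λ, ε ≤ l → ω.1 l = ω'.1 l) : uDist ω ω' ≤ ε := by
  refine Real.sSup_le ?_ hε
  rintro _ ⟨l, hl, rfl⟩
  exact (not_le.1 fun hle => hl (h l hle)).le

/-- For countable `Λ ⊆ (0,∞)`, the ultrametric Urysohn space `(M_Λ, uDist)` is complete:
every Cauchy sequence converges. -/
theorem urysohnSpace_complete
    (Λ : Set ℝ) (hΛc : Λ.Countable) (hΛ : ∀ r ∈ Λ, 0 < r)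
    (x : ℕ → UrysohnPt Λ)
    (hcauchy : ∀ ε : ℝ, 0 < ε → ∃ N : ℕ, ∀ m ≥ N, ∀ n ≥ N, uDist (x m) (x n) < ε) :
    ∃ y : UrysohnPt Λ, ∀ ε : ℝ, 0 < ε → ∃ N : ℕ, ∀ n ≥ N, uDist (x n) y < ε := by
  choose N hN using hcauchy
  let y : Λ → ℤ := fun l => (x (N l (hΛ l l.2))).1 l
  have hy : ∀ ε (hε : 0 < ε), ∀ n ≥ N ε hε, ∀ l : Λ, ε ≤ l → (x n).1 l = y l := by
    intro ε hε n hn l hl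
    have hl0 := hΛ l l.2
    exact (eq_of_uDist_lt (hN ε hε n hn _ (le_max_left _ (N l hl0))) hl).trans
      (eq_of_uDist_lt (hN l hl0 _ (le_max_right _ _) _ le_rfl) le_rfl)
  refine ⟨⟨y, fun ε hε => ((x (N ε hε)).2 ε hε).subset ?_⟩, fun ε hε => ?_⟩
  · rintro l ⟨hl, hne⟩
    exact ⟨hl, by rwa [hy ε hε _ le_rfl l hl]⟩
  · exact ⟨N (ε / 2) (half_pos hε), fun n hn =>
      (uDist_le_of_forall_eq (half_pos hε).le (hy _ _ n hn)).trans_lt (half_lt_self hε)⟩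
end

section
/- Let Λ ⊆ (0,∞). The space (M_Λ, d) has the Ismagilov property: for every ω ∈ M_Λ and every λ ∈ Λ there exists a sequence ω₀, ω₁, ω₂, … in M_Λ with ω₀ = ω and d(ω_i, ω_j) = λ for all i ≠ j. -/
open Classical in
/-- The point of `M_Λ` obtained from `ω` by replacing its value at `a` with `n`. -/
noncomputable def UrysohnPt.update {Λ : Set ℝ} (ω : UrysohnPt Λ) (a : Λ) (n : ℤ) :
    UrysohnPt Λ :=
  ⟨Function.update ω.1 a n, fun ε hε => ((ω.2 ε hε).insert a).subset fun l hl => by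
    by_cases h : l = a
    · exact Or.inl h
    · exact Or.inr ⟨hl.1, by simpa [h] using hl.2⟩⟩

theorem UrysohnPt.update_self {Λ : Set ℝ} (ω : UrysohnPt Λ) (a : Λ) :
    ω.update a (ω.1 a) = ω :=
  Subtype.ext (Function.update_eq_self a ω.1)

theorem UrysohnPt.uDist_update_update {Λ : Set ℝ} (ω : UrysohnPt Λ) (a : Λ) {m n : ℤ}
    (h : m ≠ n) : uDist (ω.update a m) (ω.update a n) = a := by
  have hset : {l : Λ | (ω.update a m).1 l ≠ (ω.update a n).1 l} = {a} := by
    ext l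
    by_cases hl : l = a
    · subst hl
      simpa [UrysohnPt.update] using h
    · simp [UrysohnPt.update, hl]
  rw [uDist, hset, Set.image_singleton, csSup_singleton]

/-- The Ismagilov property of `(M_Λ, uDist)`: for every `ω ∈ M_Λ` and `λ ∈ Λ` there is a
sequence `ω₀ = ω, ω₁, ω₂, …` with all pairwise distances equal to `λ`. -/
theorem urysohnSpace_ismagilov_property
    (Λ : Set ℝ) (hΛ : ∀ r ∈ Λ, 0 < r)
    (ω : UrysohnPt Λ) (r : ℝ) (hr : r ∈ Λ) :
    ∃ f : ℕ → UrysohnPt Λ, f 0 = ω ∧ ∀ i j : ℕ, i ≠ j → uDist (f i) (f j) = r := by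
  refine ⟨fun i => ω.update ⟨r, hr⟩ (ω.1 ⟨r, hr⟩ + i), ?_, fun i j hij => ?_⟩
  · simpa using ω.update_self ⟨r, hr⟩
  · exact ω.uDist_update_update ⟨r, hr⟩ (by simpa using hij)
end

section
/- Let Λ ⊆ (0,∞) and let U be a nonempty ultrametric space whose spectrum is contained in Λ and which has the Ismagilov property: for every x ∈ U and every λ ∈ Λ there exists a sequence x₀, x₁, x₂, … in U with x₀ = x and d(x_i, x_j) = λ for all i ≠ j. Let Y be a finite ultrametric space whose spectrum is contained in Λ, let y₀ ∈ Y, and let ψ : Y \ {y₀} → U be an isometric embedding. Then ψ extends to an isometric embedding of Y into U. -/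
/-- In an ultrametric space, an infinite equidistant sequence has a term at distance at least
the common distance from each point of a given finite family. -/
theorem exists_forall_le_dist_of_equidistant {U ι : Type*} [MetricSpace U] [Finite ι]
    (hU : ∀ x y z : U, dist x z ≤ max (dist x y) (dist y z)) {r : ℝ} {f : ℕ → U}
    (hf : ∀ i j : ℕ, i ≠ j → dist (f i) (f j) = r) (p : ι → U) :
    ∃ n, ∀ b, r ≤ dist (f n) (p b) := by
  by_contra! h
  choose g hg using h
  obtain ⟨i, j, hij, hgij⟩ := Finite.exists_ne_map_eq_of_infinite g
  have hi := hg i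
  have hj := hg j
  rw [← hgij, dist_comm] at hj
  have := hU (f i) (p (g i)) (f j)
  rw [hf i j hij] at this
  exact absurd this (not_le.mpr (max_lt hi hj))

/-- One-point extension from the Ismagilov property: if `U` is a nonempty ultrametric space
with spectrum contained in `Λ` having the Ismagilov property, `Y` is a finite ultrametric
space with spectrum contained in `Λ`, `y₀ ∈ Y`, and `ψ : Y \ {y₀} → U` is an isometric
embedding, then `ψ` extends to an isometric embedding of `Y` into `U`. -/
theorem ismagilov_implies_one_point_extension
    (Λ : Set ℝ) (hΛ : ∀ r ∈ Λ, 0 < r)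
    (U : Type*) [MetricSpace U] [Nonempty U]
    (hUu : ∀ x y z : U, dist x z ≤ max (dist x y) (dist y z))
    (hUspec : ∀ x y : U, x ≠ y → dist x y ∈ Λ)
    (hIsm : ∀ (x : U), ∀ r ∈ Λ, ∃ f : ℕ → U, f 0 = x ∧
      ∀ i j : ℕ, i ≠ j → dist (f i) (f j) = r)
    (Y : Type*) [MetricSpace Y] [Finite Y]
    (hYu : ∀ x y z : Y, dist x z ≤ max (dist x y) (dist y z))
    (hYspec : ∀ x y : Y, x ≠ y → dist x y ∈ Λ)
    (y₀ : Y) (ψ : {y : Y // y ≠ y₀} → U)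
    (hψ : ∀ a b : {y : Y // y ≠ y₀}, dist (ψ a) (ψ b) = dist (a : Y) (b : Y)) :
    ∃ Ψ : Y → U, (∀ a b : Y, dist (Ψ a) (Ψ b) = dist a b) ∧
      ∀ a : {y : Y // y ≠ y₀}, Ψ (a : Y) = ψ a := by
  classical
  suffices h : ∃ u : U, ∀ b : {y : Y // y ≠ y₀}, dist u (ψ b) = dist y₀ (b : Y) by
    obtain ⟨u, hu⟩ := h
    refine ⟨fun y => if h : y = y₀ then u else ψ ⟨y, h⟩, fun a b => ?_, fun a => dif_neg a.2⟩
    by_cases ha : a = y₀ <;> by_cases hb : b = y₀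
    · simp [ha, hb]
    · simpa [ha, hb] using hu ⟨b, hb⟩
    · simpa [ha, hb, dist_comm] using hu ⟨a, ha⟩
    · simpa [ha, hb] using hψ ⟨a, ha⟩ ⟨b, hb⟩
  rcases isEmpty_or_nonempty {y : Y // y ≠ y₀} with _ | _
  · exact ⟨Classical.arbitrary U, fun b => isEmptyElim b⟩
  obtain ⟨a, ha⟩ := Finite.exists_min fun b : {y : Y // y ≠ y₀} => dist y₀ (b : Y)
  have hr : dist y₀ (a : Y) ∈ Λ := hYspec _ _ a.2.symm
  have hr_pos := hΛ _ hr
  obtain ⟨f, hf0, hf⟩ := hIsm (ψ a) _ hr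
  obtain ⟨n, hn⟩ := exists_forall_le_dist_of_equidistant hUu hf ψ
  have hn0 : n ≠ 0 := by
    rintro rfl
    have := hn a
    rw [hf0, dist_self] at this
    exact absurd this (not_le.mpr hr_pos)
  have hna : dist (f n) (ψ a) = dist y₀ (a : Y) := hf0 ▸ hf n 0 hn0
  refine ⟨f n, fun b => ?_⟩
  have hab := hψ a b
  have hmin := ha b
  have hnb := hn b
  have hY₁ := hYu y₀ a b
  have hY₂ := hYu a y₀ b
  have hU₁ := hUu (f n) (ψ a) (ψ b)
  have hU₂ := hUu (ψ a) (f n) (ψ b)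
  rw [dist_comm (a : Y) y₀] at hY₂
  rw [dist_comm (ψ a) (f n)] at hU₂
  grind
end

section
/- Let Λ ⊆ (0,∞) be countable, nonempty, and without a maximal element. Then the group Isom(M_Λ) of surjective isometries of M_Λ admits a nontrivial affine isometric action on a real Hilbert space: there exist a group homomorphism ρ from Isom(M_Λ) to the group of surjective (not necessarily linear) isometries of ℓ²(ℕ; ℝ) and a vector h ∈ ℓ²(ℕ; ℝ) whose orbit {ρ(g)(h) : g ∈ Isom(M_Λ)} is unbounded; in particular, no point of ℓ²(ℕ; ℝ) is fixed by all the maps ρ(g). -/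
/-- The group `Isom(M_Λ)` of surjective isometries of `M_Λ`, realized as the subgroup of
permutations of `M_Λ` preserving `uDist`. -/
noncomputable def urysohnIsomGroup (Λ : Set ℝ) : Subgroup (Equiv.Perm (UrysohnPt Λ)) where
  carrier := {f : Equiv.Perm (UrysohnPt Λ) |
    ∀ ω ω' : UrysohnPt Λ, uDist (f ω) (f ω') = uDist ω ω'}
  one_mem' := by intro ω ω'; rfl
  mul_mem' := by
    intro f g hf hg ω ω'
    rw [Equiv.Perm.mul_apply, Equiv.Perm.mul_apply, hf, hg]
  inv_mem' := by
    intro f hf ω ω'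
    have h := hf (f⁻¹ ω) (f⁻¹ ω')
    simpa using h.symm

/-! ### Affine actions on `ℓ²` from almost invariant functions -/

theorem memlp_two_comp_equiv {V W : Type*} {f : V → ℝ} (hf : Memℓp f 2) (σ : W ≃ V) :
    Memℓp (f ∘ σ) 2 := by
  rw [memℓp_gen_iff (by norm_num)] at hf ⊢
  exact σ.summable_iff.mpr hf

theorem memlp_of_finite_support {V : Type*} {f : V → ℝ} (hf : {v | f v ≠ 0}.Finite) :
    Memℓp f 2 :=
  (memℓp_zero hf).of_exponent_ge (by simp)

theorem lp_two_norm_eq_of_comp_equiv {V : Type*} (f g : lp (fun _ : V => ℝ) 2)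
    (σ : Equiv.Perm V) (h : ∀ v, g v = f (σ v)) : ‖g‖ = ‖f‖ := by
  rw [lp.norm_eq_tsum_rpow (by norm_num), lp.norm_eq_tsum_rpow (by norm_num)]
  simp only [h]
  rw [σ.tsum_eq (fun v => ‖f v‖ ^ (2 : ENNReal).toReal)]

/-- The affine map `f ↦ (f + a) ∘ σ - a` of `ℓ²(V)`, for a function `a` that `σ` changes at
finitely many points only. -/
noncomputable def affineShift {V : Type*} (a : V → ℝ) (σ : Equiv.Perm V)
    (h : {v | a (σ v) ≠ a v}.Finite) (f : lp (fun _ : V => ℝ) 2) : lp (fun _ : V => ℝ) 2 :=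
  ⟨fun v => f (σ v) + (a (σ v) - a v),
    (memlp_two_comp_equiv (lp.memℓp f) σ).add
      (memlp_of_finite_support (by simpa only [ne_eq, sub_eq_zero] using h))⟩

theorem affineShift_apply {V : Type*} (a : V → ℝ) (σ : Equiv.Perm V)
    (h : {v | a (σ v) ≠ a v}.Finite) (f : lp (fun _ : V => ℝ) 2) (v : V) :
    affineShift a σ h f v = f (σ v) + (a (σ v) - a v) := rfl

theorem isometry_affineShift {V : Type*} (a : V → ℝ) (σ : Equiv.Perm V)
    (h : {v | a (σ v) ≠ a v}.Finite) : Isometry (affineShift a σ h) := by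
  refine Isometry.of_dist_eq fun f f' => ?_
  rw [dist_eq_norm, dist_eq_norm]
  refine lp_two_norm_eq_of_comp_equiv _ _ σ fun v => ?_
  simp only [lp.coeFn_sub, Pi.sub_apply, affineShift_apply]
  ring

/-- The affine isometric action `f ↦ (f + a) ∘ g⁻¹ - a` on `ℓ²(V)` of a group `G` permuting `V`,
for a function `a` that every element of `G` changes at finitely many points only. -/
noncomputable def affineShiftHom {G V : Type*} [Group G] (φ : G →* Equiv.Perm V) (a : V → ℝ)
    (ha : ∀ g, {v | a (φ g v) ≠ a v}.Finite) :
    G →* (lp (fun _ : V => ℝ) 2 ≃ᵢ lp (fun _ : V => ℝ) 2) where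
  toFun g := IsometryEquiv.mk' (affineShift a (φ g⁻¹) (ha _)) (affineShift a (φ g) (ha _))
    (fun f => by
      ext v
      have h : φ g (φ g⁻¹ v) = v := by rw [← Equiv.Perm.mul_apply, ← map_mul]; simp
      simp only [affineShift_apply, h]
      ring)
    (isometry_affineShift _ _ _)
  map_one' := by
    ext f v
    change f (φ 1⁻¹ v) + (a (φ 1⁻¹ v) - a v) = f v
    simp
  map_mul' g g' := by
    ext f v
    change f (φ (g * g')⁻¹ v) + (a (φ (g * g')⁻¹ v) - a v) =
      f (φ g'⁻¹ (φ g⁻¹ v)) + (a (φ g'⁻¹ (φ g⁻¹ v)) - a (φ g⁻¹ v)) + (a (φ g⁻¹ v) - a v)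
    rw [mul_inv_rev, map_mul, Equiv.Perm.mul_apply]
    ring

theorem affineShiftHom_apply {G V : Type*} [Group G] (φ : G →* Equiv.Perm V) (a : V → ℝ)
    (ha : ∀ g, {v | a (φ g v) ≠ a v}.Finite) (g : G) (f : lp (fun _ : V => ℝ) 2) (v : V) :
    affineShiftHom φ a ha g f v = f (φ g⁻¹ v) + (a (φ g⁻¹ v) - a v) := rfl

theorem not_isBounded_range_affineShiftHom {G V : Type*} [Group G] (φ : G →* Equiv.Perm V)
    (a : V → ℝ) (ha : ∀ g, {v | a (φ g v) ≠ a v}.Finite)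
    (hunb : ∀ N : ℕ, ∃ g, ∃ s : Finset V, N ≤ s.card ∧ ∀ v ∈ s, 1 ≤ |a (φ g v) - a v|) :
    ¬ Bornology.IsBounded (Set.range fun g => affineShiftHom φ a ha g 0) := by
  intro hb
  obtain ⟨C, hC⟩ := hb.exists_norm_le
  obtain ⟨N, hN⟩ := exists_nat_gt (C ^ 2)
  obtain ⟨g, s, hs, hsa⟩ := hunb N
  set f := affineShiftHom φ a ha g⁻¹ 0 with hf
  have hfC : ‖f‖ ≤ C := hC _ ⟨g⁻¹, rfl⟩
  have hsum : ∑ v ∈ s, ‖f v‖ ^ (2 : ENNReal).toReal ≤ ‖f‖ ^ (2 : ENNReal).toReal :=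
    lp.sum_rpow_le_norm_rpow (by norm_num) f s
  have hcard : (s.card : ℝ) ≤ ∑ v ∈ s, ‖f v‖ ^ (2 : ENNReal).toReal := by
    rw [← nsmul_one, ← Finset.sum_const]
    refine Finset.sum_le_sum fun v hv => Real.one_le_rpow ?_ (by norm_num)
    rw [hf, affineShiftHom_apply]
    simpa using hsa v hv
  have hsq : ‖f‖ ^ (2 : ENNReal).toReal = ‖f‖ ^ 2 := by
    rw [ENNReal.toReal_ofNat, Real.rpow_ofNat]
  have hle : ‖f‖ ^ 2 ≤ C ^ 2 := pow_le_pow_left₀ (norm_nonneg f) hfC 2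
  have hNs : (N : ℝ) ≤ s.card := by exact_mod_cast hs
  linarith

theorem exists_apply_ne_of_not_isBounded_orbit {G X : Type*} [Group G] [PseudoMetricSpace X]
    (ρ : G →* (X ≃ᵢ X)) (h : X) (hb : ¬ Bornology.IsBounded (Set.range fun g => ρ g h)) (p : X) :
    ∃ g, ρ g p ≠ p := by
  by_contra! hp
  refine hb (Metric.isBounded_closedBall (x := p) (r := dist h p) |>.subset ?_)
  rintro _ ⟨g, rfl⟩
  rw [Metric.mem_closedBall]
  exact (congrArg (dist (ρ g h)) (hp g)).symm.trans ((ρ g).dist_eq h p) |>.le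

/-! ### The balls of `M_Λ` -/

theorem exists_forall_gt_eq {Λ : Set ℝ} (hΛ : ∀ t ∈ Λ, 0 < t) [Nonempty Λ] (ω ω' : UrysohnPt Λ) :
    ∃ l : Λ, ∀ m, l < m → ω.1 m = ω'.1 m := by
  obtain ⟨l₀⟩ := ‹Nonempty Λ›
  have hpos := hΛ l₀ l₀.2
  obtain ⟨b, hb⟩ := ((ω.2 l₀ hpos).union (ω'.2 l₀ hpos)).bddAbove
  refine ⟨max b l₀, fun m hm => ?_⟩
  have hb' : b < m := (le_max_left _ _).trans_lt hm
  have hl : (l₀ : ℝ) ≤ m := ((le_max_right b l₀).trans_lt hm).le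
  by_contra hne
  refine hb'.not_ge (hb ?_)
  by_cases h0 : ω.1 m = 0
  · exact Or.inr ⟨hl, fun h => hne (h0.trans h.symm)⟩
  · exact Or.inl ⟨hl, h0⟩

theorem uDist_le_iff {Λ : Set ℝ} (hΛ : ∀ t ∈ Λ, 0 < t) (ω ω' : UrysohnPt Λ) (l : Λ) :
    uDist ω ω' ≤ l ↔ ∀ m, l < m → ω.1 m = ω'.1 m := by
  constructor
  · intro h m hm
    by_contra hne
    have : Nonempty Λ := ⟨l⟩
    obtain ⟨b, hb⟩ := exists_forall_gt_eq hΛ ω ω'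
    have hbdd : BddAbove ((fun l : Λ => (l : ℝ)) '' {l : Λ | ω.1 l ≠ ω'.1 l}) := by
      refine ⟨b, ?_⟩
      rintro _ ⟨k, hk, rfl⟩
      exact not_lt.mp fun hbk => hk (hb k hbk)
    exact (Subtype.coe_lt_coe.mpr hm).not_ge ((le_csSup hbdd ⟨m, hne, rfl⟩).trans h)
  · intro h
    refine Real.sSup_le ?_ (hΛ l l.2).le
    rintro _ ⟨k, hk, rfl⟩
    exact not_lt.mp fun hlk => hk (h k hlk)

/-- Two points of `M_Λ` are equivalent when they lie in the same closed ball of radius `l`. -/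
def ballSetoid {Λ : Set ℝ} (hΛ : ∀ t ∈ Λ, 0 < t) (l : Λ) : Setoid (UrysohnPt Λ) where
  r ω ω' := uDist ω ω' ≤ l
  iseqv :=
    { refl ω := (uDist_le_iff hΛ ω ω l).mpr fun _ _ => rfl
      symm {ω ω'} h := by
        rw [uDist_le_iff hΛ] at h ⊢
        exact fun m hm => (h m hm).symm
      trans {ω ω' ω''} h h' := by
        rw [uDist_le_iff hΛ] at h h' ⊢
        exact fun m hm => (h m hm).trans (h' m hm) }

/-- The closed balls of `M_Λ` of radius `l`. -/
abbrev UBall {Λ : Set ℝ} (hΛ : ∀ t ∈ Λ, 0 < t) (l : Λ) : Type := Quotient (ballSetoid hΛ l)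

/-- The closed ball of radius `l` around `ω`. -/
def uBall {Λ : Set ℝ} (hΛ : ∀ t ∈ Λ, 0 < t) (l : Λ) (ω : UrysohnPt Λ) : UBall hΛ l :=
  Quotient.mk (ballSetoid hΛ l) ω

theorem uBall_eq_iff {Λ : Set ℝ} (hΛ : ∀ t ∈ Λ, 0 < t) (l : Λ) (ω ω' : UrysohnPt Λ) :
    uBall hΛ l ω = uBall hΛ l ω' ↔ uDist ω ω' ≤ l :=
  Quotient.eq (r := ballSetoid hΛ l)

/-- A finitely supported function, as a point of `M_Λ`. -/
def UrysohnPt.ofFinsupp {Λ : Set ℝ} (f : Λ →₀ ℤ) : UrysohnPt Λ :=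
  ⟨f, fun _ _ => f.hasFiniteSupport.subset fun _ h => h.2⟩

theorem countable_uBall {Λ : Set ℝ} (hΛ : ∀ t ∈ Λ, 0 < t) (hΛc : Λ.Countable) (l : Λ) :
    Countable (UBall hΛ l) := by
  have : Countable Λ := hΛc.to_subtype
  refine Function.Surjective.countable (f := fun f : Λ →₀ ℤ => uBall hΛ l (.ofFinsupp f)) ?_
  intro q
  obtain ⟨ω, rfl⟩ := Quotient.exists_rep q
  refine ⟨Finsupp.onFinset (ω.2 l (hΛ l l.2)).toFinset (fun m => if l < m then ω.1 m else 0) ?_,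
    (uBall_eq_iff hΛ l _ _).mpr ((uDist_le_iff hΛ _ _ l).mpr ?_)⟩
  · intro m hm
    rw [ne_eq, ite_eq_right_iff, Classical.not_imp] at hm
    simpa using ⟨hm.1.le, hm.2⟩
  · intro m hm
    simp [UrysohnPt.ofFinsupp, hm]

/-- The action of `Isom(M_Λ)` on the closed balls of radii `r 0, r 1, …`. -/
def ballAction {Λ : Set ℝ} (hΛ : ∀ t ∈ Λ, 0 < t) (r : ℕ → Λ) :
    urysohnIsomGroup Λ →* Equiv.Perm (Σ n, UBall hΛ (r n)) where
  toFun g := Equiv.sigmaCongrRight fun n =>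
    Quotient.congr (ra := ballSetoid hΛ (r n)) (rb := ballSetoid hΛ (r n)) g.1
      fun ω ω' => by
        change uDist ω ω' ≤ r n ↔ uDist (g.1 ω) (g.1 ω') ≤ r n
        rw [g.2 ω ω']
  map_one' := by
    ext1 ⟨n, q⟩
    induction q using Quotient.inductionOn
    rfl
  map_mul' g g' := by
    ext1 ⟨n, q⟩
    induction q using Quotient.inductionOn
    rfl

theorem ballAction_apply {Λ : Set ℝ} (hΛ : ∀ t ∈ Λ, 0 < t) (r : ℕ → Λ) (g : urysohnIsomGroup Λ)
    (n : ℕ) (ω : UrysohnPt Λ) :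
    ballAction hΛ r g ⟨n, uBall hΛ (r n) ω⟩ = ⟨n, uBall hΛ (r n) (g.1 ω)⟩ := rfl

open Classical in
/-- The indicator function of the set of balls containing `ω`. -/
noncomputable def ballIndicator {Λ : Set ℝ} (hΛ : ∀ t ∈ Λ, 0 < t) (r : ℕ → Λ) (ω : UrysohnPt Λ)
    (v : Σ n, UBall hΛ (r n)) : ℝ :=
  if v.2 = uBall hΛ (r v.1) ω then 1 else 0

open Classical in
theorem ballIndicator_mk {Λ : Set ℝ} (hΛ : ∀ t ∈ Λ, 0 < t) (r : ℕ → Λ) (ω : UrysohnPt Λ)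
    (n : ℕ) (q : UBall hΛ (r n)) :
    ballIndicator hΛ r ω ⟨n, q⟩ = if q = uBall hΛ (r n) ω then 1 else 0 := rfl

theorem finite_ballIndicator_ne {Λ : Set ℝ} (hΛ : ∀ t ∈ Λ, 0 < t) {r : ℕ → Λ}
    (hr : Filter.Tendsto r Filter.atTop Filter.atTop) (ω : UrysohnPt Λ) (g : urysohnIsomGroup Λ) :
    {v | ballIndicator hΛ r ω (ballAction hΛ r g v) ≠ ballIndicator hΛ r ω v}.Finite := by
  have : Nonempty Λ := ⟨r 0⟩
  obtain ⟨l, hl⟩ := exists_forall_gt_eq hΛ (g.1 ω) ω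
  obtain ⟨N, hN⟩ := Filter.eventually_atTop.mp (hr.eventually_ge_atTop l)
  refine (((Set.finite_lt_nat N).image fun n => (⟨n, uBall hΛ (r n) ω⟩ : Σ n, UBall hΛ (r n))).union
    ((Set.finite_lt_nat N).image fun n =>
      (⟨n, uBall hΛ (r n) (g.1.symm ω)⟩ : Σ n, UBall hΛ (r n)))).subset ?_
  rintro ⟨n, q⟩ hv
  obtain ⟨η, rfl⟩ : ∃ η, uBall hΛ (r n) η = q := Quotient.exists_rep q
  have hback : uBall hΛ (r n) (g.1 η) = uBall hΛ (r n) ω ↔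
      uBall hΛ (r n) η = uBall hΛ (r n) (g.1.symm ω) := by
    rw [uBall_eq_iff, uBall_eq_iff, ← g.2 η, Equiv.apply_symm_apply]
  have hfwd : uBall hΛ (r n) (g.1 η) = uBall hΛ (r n) (g.1 ω) ↔
      uBall hΛ (r n) η = uBall hΛ (r n) ω := by
    rw [uBall_eq_iff, uBall_eq_iff, g.2]
  have hn : n < N := by
    by_contra! hn
    have hfix : uBall hΛ (r n) (g.1 ω) = uBall hΛ (r n) ω :=
      (uBall_eq_iff _ _ _ _).mpr ((uDist_le_iff hΛ _ _ _).mpr fun m hm =>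
        hl m ((hN n hn).trans_lt hm))
    rw [hfix] at hfwd
    by_cases h : uBall hΛ (r n) η = uBall hΛ (r n) ω
    · simp [ballIndicator_mk, ballAction_apply, h, hfix] at hv
    · simp [ballIndicator_mk, ballAction_apply, h, mt hfwd.mp h] at hv
  by_cases h : uBall hΛ (r n) η = uBall hΛ (r n) ω
  · exact Or.inl ⟨n, hn, by rw [h]⟩
  · refine Or.inr ⟨n, hn, ?_⟩
    have h' : uBall hΛ (r n) (g.1 η) = uBall hΛ (r n) ω := by
      by_contra h'
      simp [ballIndicator_mk, ballAction_apply, h, h'] at hv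
    rw [hback.mp h']

/-- The translation of `M_Λ` by a finitely supported function. -/
def UrysohnPt.translate {Λ : Set ℝ} (f : Λ →₀ ℤ) (ω : UrysohnPt Λ) : UrysohnPt Λ :=
  ⟨fun l => ω.1 l + f l, fun ε hε => ((ω.2 ε hε).union f.hasFiniteSupport).subset fun l hl => by
    by_cases h : ω.1 l = 0
    · exact Or.inr fun hf => hl.2 (by simp [h, hf])
    · exact Or.inl ⟨hl.1, h⟩⟩

/-- The translation by a finitely supported function, as an isometry of `M_Λ`. -/
noncomputable def translateIsom {Λ : Set ℝ} (f : Λ →₀ ℤ) : urysohnIsomGroup Λ :=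
  ⟨⟨UrysohnPt.translate f, UrysohnPt.translate (-f),
    fun ω => by ext; simp [UrysohnPt.translate], fun ω => by ext; simp [UrysohnPt.translate]⟩,
    fun ω ω' => by simp [uDist, UrysohnPt.translate]⟩

theorem translateIsom_apply {Λ : Set ℝ} (f : Λ →₀ ℤ) (ω : UrysohnPt Λ) (l : Λ) :
    ((translateIsom f).1 ω).1 l = ω.1 l + f l := rfl

theorem exists_ballIndicator_sub_ge {Λ : Set ℝ} (hΛ : ∀ t ∈ Λ, 0 < t)
    (hnomax : ∀ s ∈ Λ, ∃ s' ∈ Λ, s < s') {r : ℕ → Λ} (hr : Monotone r) (ω : UrysohnPt Λ) (N : ℕ) :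
    ∃ g, ∃ s : Finset (Σ n, UBall hΛ (r n)), N ≤ s.card ∧ ∀ v ∈ s,
      1 ≤ |ballIndicator hΛ r ω (ballAction hΛ r g v) - ballIndicator hΛ r ω v| := by
  obtain ⟨l, hl, hrl⟩ := hnomax (r N) (r N).2
  refine ⟨translateIsom (Finsupp.single ⟨l, hl⟩ 1), (Finset.range N).map
    ⟨fun n => ⟨n, uBall hΛ (r n) ω⟩, fun n m h => congrArg Sigma.fst h⟩, by simp, ?_⟩
  intro v hv
  obtain ⟨n, hn, rfl⟩ := Finset.mem_map.mp hv
  have hmoved : ¬ uBall hΛ (r n) ((translateIsom (Finsupp.single ⟨l, hl⟩ 1)).1 ω) =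
      uBall hΛ (r n) ω := by
    rw [uBall_eq_iff, uDist_le_iff hΛ]
    intro h
    have hnl : r n < ⟨l, hl⟩ := (hr (Finset.mem_range.mp hn).le).trans_lt hrl
    have := h _ hnl
    simp [translateIsom_apply] at this
  change 1 ≤ |ballIndicator hΛ r ω (ballAction hΛ r _ ⟨n, uBall hΛ (r n) ω⟩) -
    ballIndicator hΛ r ω ⟨n, uBall hΛ (r n) ω⟩|
  simp [ballIndicator_mk, ballAction_apply, hmoved]

/-- For countable nonempty `Λ ⊆ (0,∞)` without a maximal element, the group `Isom(M_Λ)`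
admits a nontrivial affine isometric action on the real Hilbert space `ℓ²(ℕ; ℝ)`: a
homomorphism into the isometry group of `ℓ²(ℕ; ℝ)` with an unbounded orbit, and in
particular with no common fixed point. -/
theorem urysohnIsomGroup_nontrivial_affine_isometric_action
    (Λ : Set ℝ) (hΛc : Λ.Countable) (hΛne : Λ.Nonempty) (hΛ : ∀ t ∈ Λ, 0 < t)
    (hnomax : ∀ r ∈ Λ, ∃ r' ∈ Λ, r < r') :
    ∃ ρ : urysohnIsomGroup Λ →* (lp (fun _ : ℕ => ℝ) 2 ≃ᵢ lp (fun _ : ℕ => ℝ) 2),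
      ∃ h : lp (fun _ : ℕ => ℝ) 2,
        (¬ Bornology.IsBounded
          (Set.range fun g : urysohnIsomGroup Λ => ρ g h)) ∧
        ∀ p : lp (fun _ : ℕ => ℝ) 2, ∃ g : urysohnIsomGroup Λ, ρ g p ≠ p := by
  have : Countable Λ := hΛc.to_subtype
  have : Nonempty Λ := hΛne.to_subtype
  obtain ⟨r, hr, hrt⟩ := Filter.exists_seq_monotone_tendsto_atTop_atTop Λ
  have (n : ℕ) : Countable (UBall hΛ (r n)) := countable_uBall hΛ hΛc (r n)
  let ω : UrysohnPt Λ := .ofFinsupp 0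
  have : Infinite (Σ n, UBall hΛ (r n)) :=
    Infinite.of_injective (fun n => ⟨n, uBall hΛ (r n) ω⟩) fun _ _ h => congrArg Sigma.fst h
  obtain ⟨e⟩ := nonempty_equiv_of_countable (α := Σ n, UBall hΛ (r n)) (β := ℕ)
  let φ : urysohnIsomGroup Λ →* Equiv.Perm ℕ :=
    e.permCongrHom.toMonoidHom.comp (ballAction hΛ r)
  have hφ (g) (k : ℕ) : e.symm (φ g k) = ballAction hΛ r g (e.symm k) := e.symm_apply_apply _
  have ha (g) : {k | (ballIndicator hΛ r ω ∘ e.symm) (φ g k) ≠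
      (ballIndicator hΛ r ω ∘ e.symm) k}.Finite := by
    simp only [Function.comp_apply, hφ]
    exact (finite_ballIndicator_ne hΛ hrt ω g).preimage e.symm.injective.injOn
  have hunb : ¬ Bornology.IsBounded (Set.range fun g => affineShiftHom φ _ ha g 0) := by
    refine not_isBounded_range_affineShiftHom φ _ ha fun N => ?_
    obtain ⟨g, s, hs, hsa⟩ := exists_ballIndicator_sub_ge hΛ hnomax hr ω N
    refine ⟨g, s.map e.toEmbedding, by simpa using hs, fun k hk => ?_⟩
    obtain ⟨v, hv, rfl⟩ := Finset.mem_map.mp hk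
    simpa [hφ] using hsa v hv
  exact ⟨affineShiftHom φ _ ha, 0, hunb, exists_apply_ne_of_not_isBounded_orbit _ 0 hunb⟩
end
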